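/- For every integer n with n = 4, n = 5, or n ≥ 7, the following exact value holds: the minimum even integer m such that every graphical sequence S of n nonnegative integers with σ(S) ≥ m has a realization containing K₄−e as a subgraph equals 3n − 1 if n is odd and 3n − 2 if n is even (i.e., σ(K₄−e, n) = 2⌊(3n−1)/2⌋). -/

import Mathlib

open scoped Classical

noncomputable section

/-- `H` is contained in `G` as a subgraph: there is an injective map of vertices
carrying edges of `H` to edges of `G`. -/
def ContainsSub {W V : Type*} (G : SimpleGraph V) (H : SimpleGraph W) : Prop :=
  ∃ f : W ↪ V, ∀ a b, H.Adj a b → G.Adj (f a) (f b)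

/-- The graph `K₄ - e`: the complete graph on 4 vertices with the edge `{0,1}` deleted. -/
def K4e : SimpleGraph (Fin 4) :=
  SimpleGraph.fromEdgeSet {s(0,2), s(0,3), s(1,2), s(1,3), s(2,3)}

/-- `G` is a realization of the sequence `S`: the degree sequence of `G` is
precisely `S` (as a multiset, i.e. up to reordering). -/
def IsRealization {n : ℕ} (S : Fin n → ℕ) (G : SimpleGraph (Fin n)) : Prop :=
  letI : DecidableRel G.Adj := Classical.decRel _
  Multiset.map (fun v => G.degree v) Finset.univ.val = Multiset.map S Finset.univ.val

/-- A sequence of nonnegative integers is graphical if some simple graph realizes it. -/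
def Graphical {n : ℕ} (S : Fin n → ℕ) : Prop :=
  ∃ G : SimpleGraph (Fin n), IsRealization S G


section Degrees

variable {V : Type*}

/-- `G` contains two triangles `p q r` and `p q t` sharing the edge `p q`. -/
def HasDiamond (G : SimpleGraph V) : Prop :=
  ∃ p q r t, r ≠ t ∧ G.Adj p q ∧ G.Adj p r ∧ G.Adj p t ∧ G.Adj q r ∧ G.Adj q t

theorem HasDiamond.mono {G H : SimpleGraph V} (h : HasDiamond G) (hGH : G ≤ H) :
    HasDiamond H := by
  obtain ⟨p, q, r, t, hrt, h1, h2, h3, h4, h5⟩ := h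
  exact ⟨p, q, r, t, hrt, hGH h1, hGH h2, hGH h3, hGH h4, hGH h5⟩

/-- The graph `G` with all edges at `v` removed. -/
def isolate (G : SimpleGraph V) (v : V) : SimpleGraph V where
  Adj x y := G.Adj x y ∧ x ≠ v ∧ y ≠ v
  symm := ⟨fun _ _ h => ⟨h.1.symm, h.2.2, h.2.1⟩⟩
  loopless := ⟨fun _ h => h.1.ne rfl⟩

/-- The graph formed by the edges of `G` at `v`. -/
def starAt (G : SimpleGraph V) (v : V) : SimpleGraph V where
  Adj x y := G.Adj x y ∧ (x = v ∨ y = v)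
  symm := ⟨fun _ _ h => ⟨h.1.symm, h.2.symm⟩⟩
  loopless := ⟨fun _ h => h.1.ne rfl⟩

theorem isolate_sup_starAt (G : SimpleGraph V) (v : V) : isolate G v ⊔ starAt G v = G := by
  ext x y
  simp only [SimpleGraph.sup_adj, isolate, starAt]
  tauto

/-- The graph `G` with the edge `a b` removed. -/
def removeEdge (G : SimpleGraph V) (a b : V) : SimpleGraph V := G \ SimpleGraph.edge a b

theorem removeEdge_adj {G : SimpleGraph V} {a b x y : V} :
    (removeEdge G a b).Adj x y ↔ G.Adj x y ∧ ¬ (x = a ∧ y = b) ∧ ¬ (x = b ∧ y = a) := by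
  simp only [removeEdge, SimpleGraph.sdiff_adj, SimpleGraph.edge_adj]
  constructor
  · rintro ⟨h, h2⟩
    have := h.ne
    tauto
  · tauto

variable [Fintype V]

/-- The degree of a vertex, written as a sum of adjacency indicators. -/
def vdeg (G : SimpleGraph V) (v : V) : ℕ := ∑ x, if G.Adj v x then 1 else 0

/-- Some graph with the same degree at every vertex as `G` contains a diamond. -/
def PotDiamond (G : SimpleGraph V) : Prop :=
  ∃ H : SimpleGraph V, (∀ x, vdeg H x = vdeg G x) ∧ HasDiamond H

theorem PotDiamond.congr {G H : SimpleGraph V} (h : PotDiamond H)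
    (hdeg : ∀ x, vdeg H x = vdeg G x) : PotDiamond G := by
  obtain ⟨K, hK, hd⟩ := h
  exact ⟨K, fun x => (hK x).trans (hdeg x), hd⟩

theorem HasDiamond.pot {G : SimpleGraph V} (h : HasDiamond G) : PotDiamond G :=
  ⟨G, fun _ => rfl, h⟩

theorem vdeg_eq_degree (G : SimpleGraph V) [DecidableRel G.Adj] (v : V) :
    vdeg G v = G.degree v := by
  rw [← SimpleGraph.card_neighborFinset_eq_degree, SimpleGraph.neighborFinset_eq_filter,
    Finset.card_filter, vdeg]
  exact Finset.sum_congr rfl fun x _ => by congr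

theorem vdeg_eq_card (G : SimpleGraph V) (v : V) :
    vdeg G v = (Finset.univ.filter fun x => G.Adj v x).card := by
  rw [Finset.card_filter, vdeg]

theorem even_sum_vdeg (G : SimpleGraph V) : Even (∑ x, vdeg G x) := by
  simp only [vdeg_eq_degree, SimpleGraph.sum_degrees_eq_twice_card_edges, even_two_mul]

theorem vdeg_sup {G H : SimpleGraph V} (hd : ∀ x y, G.Adj x y → ¬ H.Adj x y) (v : V) :
    vdeg (G ⊔ H) v = vdeg G v + vdeg H v := by
  rw [vdeg, vdeg, vdeg, ← Finset.sum_add_distrib]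
  refine Finset.sum_congr rfl fun x _ => ?_
  have := hd v x
  by_cases h1 : G.Adj v x <;> by_cases h2 : H.Adj v x <;> simp_all

theorem vdeg_edge {a b : V} (hab : a ≠ b) (x : V) :
    vdeg (SimpleGraph.edge a b) x = (if x = a then 1 else 0) + (if x = b then 1 else 0) := by
  simp only [vdeg, SimpleGraph.edge_adj]
  by_cases h1 : x = a
  · subst h1
    rw [Finset.sum_eq_single b] <;> simp +contextual [hab, hab.symm]
  · by_cases h2 : x = b
    · subst h2
      rw [Finset.sum_eq_single a] <;> simp +contextual [hab, hab.symm]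
    · simp [h1, h2]

theorem not_adj_of_vdeg_eq_zero {G : SimpleGraph V} {v : V} (h : vdeg G v = 0) (x : V) :
    ¬ G.Adj v x := by
  intro hx
  rw [vdeg, Finset.sum_eq_zero_iff] at h
  simpa [hx] using h x (Finset.mem_univ x)

theorem exists_adj_of_vdeg_pos {G : SimpleGraph V} {v : V} (h : 0 < vdeg G v) :
    ∃ x, G.Adj v x := by
  by_contra! hx
  simp [vdeg, hx] at h

theorem exists_of_vdeg_eq_two {G : SimpleGraph V} {v : V} (h : vdeg G v = 2) :
    ∃ a b, a ≠ b ∧ ∀ x, G.Adj v x ↔ x = a ∨ x = b := by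
  rw [vdeg_eq_card, Finset.card_eq_two] at h
  obtain ⟨a, b, hab, h⟩ := h
  refine ⟨a, b, hab, fun x => ?_⟩
  simpa using Finset.ext_iff.1 h x

theorem vdeg_starAt (G : SimpleGraph V) (v x : V) :
    vdeg (starAt G v) x = (if x = v then vdeg G v else 0) + (if G.Adj v x then 1 else 0) := by
  by_cases hx : x = v
  · subst hx
    simp [vdeg, starAt]
  · rw [vdeg, Finset.sum_eq_single v]
    · simp [starAt, hx, G.adj_comm]
    · simp +contextual [starAt, hx]
    · simp

theorem vdeg_isolate (G : SimpleGraph V) (v x : V) :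
    vdeg G x = vdeg (isolate G v) x +
      ((if x = v then vdeg G v else 0) + (if G.Adj v x then 1 else 0)) := by
  rw [← vdeg_starAt, ← vdeg_sup, isolate_sup_starAt]
  simp only [isolate, starAt]
  tauto

theorem vdeg_isolate_self (G : SimpleGraph V) (v : V) : vdeg (isolate G v) v = 0 := by
  simpa using vdeg_isolate G v v

theorem sum_vdeg_isolate (G : SimpleGraph V) (v : V) :
    ∑ x, vdeg G x = ∑ x, vdeg (isolate G v) x + 2 * vdeg G v := by
  rw [Finset.sum_congr rfl fun x _ => vdeg_isolate G v x, Finset.sum_add_distrib,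
    Finset.sum_add_distrib, Finset.sum_ite_eq' Finset.univ v, if_pos (Finset.mem_univ v),
    ← vdeg]
  ring

theorem PotDiamond.of_isolate {G : SimpleGraph V} {v : V} (h : PotDiamond (isolate G v)) :
    PotDiamond G := by
  obtain ⟨H, hdeg, hH⟩ := h
  have hv : ∀ x, ¬ H.Adj v x :=
    not_adj_of_vdeg_eq_zero (by rw [hdeg, vdeg_isolate_self])
  refine ⟨H ⊔ starAt G v, fun x => ?_, hH.mono le_sup_left⟩
  rw [vdeg_sup, hdeg, vdeg_starAt, ← vdeg_isolate]
  rintro x y hxy ⟨-, rfl | rfl⟩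
  · exact hv _ hxy
  · exact hv _ hxy.symm

theorem vdeg_removeEdge {G : SimpleGraph V} {a b : V} (h : G.Adj a b) (x : V) :
    vdeg G x = vdeg (removeEdge G a b) x +
      ((if x = a then 1 else 0) + (if x = b then 1 else 0)) := by
  rw [← vdeg_edge h.ne, ← vdeg_sup]
  · congr 1
    ext x y
    simp only [SimpleGraph.sup_adj, removeEdge_adj, SimpleGraph.edge_adj]
    have := h.symm
    have := @SimpleGraph.Adj.ne _ G x y
    grind
  · simp only [removeEdge_adj, SimpleGraph.edge_adj]
    tauto

theorem vdeg_sup_edge {G : SimpleGraph V} {a b : V} (hab : a ≠ b) (h : ¬ G.Adj a b) (x : V) :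
    vdeg (G ⊔ SimpleGraph.edge a b) x = vdeg G x +
      ((if x = a then 1 else 0) + (if x = b then 1 else 0)) := by
  rw [← vdeg_edge hab, ← vdeg_sup]
  intro x y hxy
  simp only [SimpleGraph.edge_adj]
  rintro ⟨⟨rfl, rfl⟩ | ⟨rfl, rfl⟩, -⟩
  · exact h hxy
  · exact h hxy.symm

/-- The switch replacing the edges `v a`, `w c` by `v w`, `a c`. -/
def switch (G : SimpleGraph V) (v a w c : V) : SimpleGraph V :=
  removeEdge (removeEdge G v a) w c ⊔ SimpleGraph.edge v w ⊔ SimpleGraph.edge a c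

theorem vdeg_switch {G : SimpleGraph V} {v a w c : V} (hva : G.Adj v a) (hwc : G.Adj w c)
    (hvw : v ≠ w) (hac : a ≠ c) (nvw : ¬ G.Adj v w) (nac : ¬ G.Adj a c) (x : V) :
    vdeg (switch G v a w c) x = vdeg G x := by
  have hne := hva.ne
  have hne' := hwc.ne
  rw [switch, vdeg_sup_edge hac, vdeg_sup_edge hvw, vdeg_removeEdge hva,
    vdeg_removeEdge (G := removeEdge G v a) (a := w) (b := c)]
  · omega
  · rw [removeEdge_adj]
    grind
  · simp only [removeEdge_adj]
    tauto
  · simp only [SimpleGraph.sup_adj, removeEdge_adj, SimpleGraph.edge_adj]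
    have := hwc.symm
    grind

/-- The graph obtained from `G` by subdividing the edge `x y` with the vertex `v`. -/
def subdivide (G : SimpleGraph V) (x y v : V) : SimpleGraph V :=
  removeEdge G x y ⊔ SimpleGraph.edge v x ⊔ SimpleGraph.edge v y

theorem vdeg_subdivide {G : SimpleGraph V} {x y v : V} (hxy : G.Adj x y)
    (hv : vdeg G v = 0) (z : V) :
    vdeg (subdivide G x y v) z = vdeg G z + if z = v then 2 else 0 := by
  have hv := not_adj_of_vdeg_eq_zero hv
  have hne := hxy.ne
  have hvx : v ≠ x := by rintro rfl; exact hv _ hxy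
  have hvy : v ≠ y := by rintro rfl; exact hv _ hxy.symm
  rw [subdivide, vdeg_sup_edge hvy, vdeg_sup_edge hvx, vdeg_removeEdge hxy]
  · split_ifs <;> omega
  · simp only [removeEdge_adj]
    exact fun h => hv _ h.1
  · simp only [SimpleGraph.sup_adj, removeEdge_adj, SimpleGraph.edge_adj]
    have := hv y
    grind

/-- Transport of a realization along an embedding whose range carries all edges. -/
theorem PotDiamond.of_embedding {W : Type*} [Fintype W] {G : SimpleGraph V} {K : SimpleGraph W}
    (f : W ↪ V) (hdeg : ∀ i, vdeg K i = vdeg G (f i))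
    (hG : ∀ x, x ∉ Set.range f → vdeg G x = 0) (hK : HasDiamond K) : PotDiamond G := by
  refine ⟨K.map f, fun x => ?_, ?_⟩
  · by_cases hx : x ∈ Set.range f
    · obtain ⟨i, rfl⟩ := hx
      rw [← hdeg, vdeg_eq_card, vdeg_eq_card, ← Finset.card_map f]
      congr 1
      ext y
      simp only [Finset.mem_filter, Finset.mem_univ, true_and, SimpleGraph.map_adj,
        Finset.mem_map]
      constructor
      · rintro ⟨a, b, h, h1, rfl⟩
        rw [f.injective h1] at h
        exact ⟨b, h, rfl⟩
      · rintro ⟨b, h, rfl⟩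
        exact ⟨i, b, h, rfl, rfl⟩
    · rw [hG x hx, vdeg, Finset.sum_eq_zero]
      intro y _
      rw [if_neg]
      rintro ⟨-, a, b, h, h1, rfl⟩
      exact hx ⟨_, h1⟩
  · obtain ⟨p, q, r, t, hrt, h1, h2, h3, h4, h5⟩ := hK
    refine ⟨f p, f q, f r, f t, f.injective.ne hrt, ?_, ?_, ?_, ?_, ?_⟩ <;>
      rwa [SimpleGraph.map_adj_apply]

end Degrees

section Supported

variable {V : Type*}

theorem isolate_supported {G : SimpleGraph V} {s : Finset V}
    (hs : ∀ x y, G.Adj x y → x ∈ s) (v : V) :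
    ∀ x y, (isolate G v).Adj x y → x ∈ s.erase v :=
  fun _ _ h => Finset.mem_erase.2 ⟨h.2.1, hs _ _ h.1⟩

variable [Fintype V]

theorem vdeg_eq_zero_of_notMem {G : SimpleGraph V} {s : Finset V}
    (hs : ∀ x y, G.Adj x y → x ∈ s) {x : V} (hx : x ∉ s) : vdeg G x = 0 := by
  rw [vdeg, Finset.sum_eq_zero]
  exact fun y _ => if_neg fun h => hx (hs _ _ h)

theorem mem_of_vdeg_pos {G : SimpleGraph V} {s : Finset V}
    (hs : ∀ x y, G.Adj x y → x ∈ s) {x : V} (hx : 0 < vdeg G x) : x ∈ s := by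
  by_contra h
  exact hx.ne' (vdeg_eq_zero_of_notMem hs h)

theorem vdeg_eq_sum {G : SimpleGraph V} {s : Finset V}
    (hs : ∀ x y, G.Adj x y → x ∈ s) (v : V) :
    vdeg G v = ∑ x ∈ s, if G.Adj v x then 1 else 0 := by
  symm
  refine Finset.sum_subset (Finset.subset_univ s) fun x _ hx => if_neg fun h => hx ?_
  exact hs _ _ h.symm

theorem sum_vdeg_eq_sum {G : SimpleGraph V} {s : Finset V}
    (hs : ∀ x y, G.Adj x y → x ∈ s) : ∑ x, vdeg G x = ∑ x ∈ s, vdeg G x := by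
  symm
  exact Finset.sum_subset (Finset.subset_univ s) fun x _ hx => vdeg_eq_zero_of_notMem hs hx

theorem hasDiamond_of_card_eq_four {G : SimpleGraph V} {s : Finset V}
    (hs : ∀ x y, G.Adj x y → x ∈ s) (hcard : s.card = 4) (hsum : 10 ≤ ∑ x, vdeg G x) :
    HasDiamond G := by
  obtain ⟨a, b, c, d, hab, hac, had, hbc, hbd, hcd, rfl⟩ := Finset.card_eq_four.1 hcard
  rw [sum_vdeg_eq_sum hs] at hsum
  simp only [vdeg_eq_sum hs] at hsum
  have e : ∀ f : V → ℕ, ∑ x ∈ ({a, b, c, d} : Finset V), f x = f a + f b + f c + f d := by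
    intro f
    rw [Finset.sum_insert, Finset.sum_insert, Finset.sum_insert, Finset.sum_singleton] <;>
      simp_all [add_assoc]
  simp only [e, SimpleGraph.irrefl, if_false, G.adj_comm b a, G.adj_comm c a, G.adj_comm d a,
    G.adj_comm c b, G.adj_comm d b, G.adj_comm d c] at hsum
  have key : (G.Adj a c ∧ G.Adj a d ∧ G.Adj b c ∧ G.Adj b d ∧ (G.Adj a b ∨ G.Adj c d)) ∨
      (G.Adj a b ∧ G.Adj c d ∧ ((G.Adj a c ∧ G.Adj b d ∧ (G.Adj a d ∨ G.Adj b c)) ∨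
        (G.Adj a d ∧ G.Adj b c ∧ (G.Adj a c ∨ G.Adj b d)))) := by
    by_cases h1 : G.Adj a b <;> by_cases h2 : G.Adj a c <;> by_cases h3 : G.Adj a d <;>
    by_cases h4 : G.Adj b c <;> by_cases h5 : G.Adj b d <;> by_cases h6 : G.Adj c d <;>
    simp [h1, h2, h3, h4, h5, h6] at hsum ⊢
  rcases key with ⟨h2, h3, h4, h5, h1 | h6⟩ |
    ⟨h1, h6, ⟨h2, h5, h3 | h4⟩ | ⟨h3, h4, h2 | h5⟩⟩
  · exact ⟨a, b, c, d, hcd, h1, h2, h3, h4, h5⟩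
  · exact ⟨c, d, a, b, hab, h6, h2.symm, h4.symm, h3.symm, h5.symm⟩
  · exact ⟨a, d, b, c, hbc, h3, h1, h2, h5.symm, h6.symm⟩
  · exact ⟨b, c, a, d, had, h4, h1.symm, h5, h2.symm, h6⟩
  · exact ⟨a, c, b, d, hbd, h2, h1, h3, h4.symm, h6⟩
  · exact ⟨b, d, a, c, hac, h5, h1.symm, h4, h3.symm, h6.symm⟩

end Supported

section Cubic

/-- The circulant graph on `ZMod (2 * k)` with connection set `{1, -1, k}`. -/
def moebiusLadder (k : ℕ) : SimpleGraph (ZMod (2 * k)) where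
  Adj i j := i ≠ j ∧ (j = i + 1 ∨ j = i - 1 ∨ j = i + k)
  symm := ⟨by
    have hk : (k : ZMod (2 * k)) + k = 0 := by
      have := ZMod.natCast_self (2 * k)
      push_cast at this
      linear_combination this
    rintro i j ⟨h, h1 | h1 | h1⟩
    · exact ⟨h.symm, Or.inr (Or.inl (by rw [h1]; ring))⟩
    · exact ⟨h.symm, Or.inl (by rw [h1]; ring)⟩
    · exact ⟨h.symm, Or.inr (Or.inr (by rw [h1]; linear_combination -hk))⟩⟩
  loopless := ⟨fun _ h => h.1 rfl⟩

theorem vdeg_moebiusLadder (k : ℕ) (hk : 2 ≤ k) [NeZero (2 * k)] (i : ZMod (2 * k)) :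
    vdeg (moebiusLadder k) i = 3 := by
  have cast_ne : ∀ a : ℕ, 0 < a → a < 2 * k → (a : ZMod (2 * k)) ≠ 0 := by
    intro a h0 h1 h
    rw [ZMod.natCast_eq_zero_iff] at h
    exact absurd (Nat.le_of_dvd h0 h) (by omega)
  have h1 := cast_ne 1 (by omega) (by omega)
  have h2 := cast_ne 2 (by omega) (by omega)
  have h3 := cast_ne k (by omega) (by omega)
  have h4 := cast_ne (k - 1) (by omega) (by omega)
  have h5 := cast_ne (k + 1) (by omega) (by omega)
  rw [Nat.cast_sub (by omega)] at h4
  push_cast at h1 h2 h4 h5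
  rw [vdeg_eq_card, Finset.card_eq_three]
  refine ⟨i + 1, i - 1, i + k, ?_, ?_, ?_, ?_⟩
  · exact fun h => h2 (by linear_combination h)
  · exact fun h => h4 (by linear_combination -h)
  · exact fun h => h5 (by linear_combination -h)
  · ext j
    rw [Finset.mem_filter]
    simp only [Finset.mem_univ, true_and, moebiusLadder, Finset.mem_insert,
      Finset.mem_singleton, and_iff_right_iff_imp]
    rintro (rfl | rfl | rfl) h
    · exact h1 (by linear_combination -h)
    · exact h1 (by linear_combination h)
    · exact h3 (by linear_combination -h)

variable {V : Type*} [Fintype V]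

theorem potDiamond_of_cubic {G : SimpleGraph V} {s : Finset V}
    (hs : ∀ x y, G.Adj x y → x ∈ s) (hcard : 8 ≤ s.card) (heven : Even s.card)
    (hdeg : ∀ x ∈ s, vdeg G x = 3) : PotDiamond G := by
  obtain ⟨k, hk⟩ : ∃ k, s.card = 4 + 2 * k := by
    obtain ⟨l, hl⟩ := heven
    exact ⟨l - 2, by omega⟩
  have : NeZero (2 * k) := ⟨by omega⟩
  have hcard' : Fintype.card (Fin 4 ⊕ ZMod (2 * k)) = Fintype.card s := by
    rw [Fintype.card_sum, Fintype.card_fin, ZMod.card, Fintype.card_coe, hk]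
  let e := Fintype.equivOfCardEq hcard'
  refine PotDiamond.of_embedding (K := (⊤ : SimpleGraph (Fin 4)) ⊕g moebiusLadder k)
    (e.toEmbedding.trans (Function.Embedding.subtype _)) ?_ ?_ ?_
  · intro i
    rw [hdeg]
    · rcases i with i | i
      · rw [vdeg, Fintype.sum_sum_type]
        simp [Finset.sum_ite, Finset.filter_ne]
      · rw [vdeg, Fintype.sum_sum_type, ← vdeg_moebiusLadder k (by omega) i, vdeg]
        simp
    · exact (e i).2
  · intro x hx
    refine vdeg_eq_zero_of_notMem hs fun h => hx ⟨e.symm ⟨x, h⟩, ?_⟩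
    simp
  · exact ⟨.inl 0, .inl 1, .inl 2, .inl 3, by simp, by simp, by simp, by simp, by simp, by simp⟩

end Cubic

section SevenVertices

variable {V : Type*} [Fintype V]

/-- A diamond-containing graph with degree sequence `(4, 1, 3, 3, 3, 3, 3)`. -/
def sevenGraph : SimpleGraph (Fin 7) :=
  SimpleGraph.fromEdgeSet {s(0, 2), s(0, 3), s(0, 4), s(2, 3), s(2, 4), s(5, 6), s(5, 3),
    s(5, 4), s(6, 1), s(6, 0)}

theorem potDiamond_of_leaf {G : SimpleGraph V} {s : Finset V} {v : V}
    (hs : ∀ x y, G.Adj x y → x ∈ s) (hcard : s.card = 7) (hv : v ∈ s) (hdv : vdeg G v = 1)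
    (hdeg : ∀ x ∈ s.erase v, vdeg (isolate G v) x = 3) : PotDiamond G := by
  obtain ⟨a, ha⟩ := exists_adj_of_vdeg_pos (G := G) (v := v) (by omega)
  have huniq : ∀ x, G.Adj v x ↔ x = a := by
    rw [vdeg_eq_card, Finset.card_eq_one] at hdv
    obtain ⟨b, hb⟩ := hdv
    have h := fun x => Finset.ext_iff.1 hb x
    simp only [Finset.mem_filter, Finset.mem_univ, true_and, Finset.mem_singleton] at h
    have := (h a).1 ha
    subst this
    exact h
  have has : a ∈ s := hs _ _ ha.symm
  have hav : a ≠ v := ha.ne'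
  have hcard' : Fintype.card (Fin 5) = Fintype.card ((s.erase v).erase a : Finset V) := by
    rw [Fintype.card_fin, Fintype.card_coe, Finset.card_erase_of_mem, Finset.card_erase_of_mem hv,
      hcard]
    exact Finset.mem_erase.2 ⟨hav, has⟩
  let e := Fintype.equivOfCardEq hcard'
  have he : ∀ i, (e i : V) ≠ a ∧ (e i : V) ≠ v ∧ (e i : V) ∈ s := by
    intro i
    simpa only [Finset.mem_erase] using (e i).2
  let f : Fin 7 → V := Fin.cons a (Fin.cons v fun i => (e i : V))
  have hf : Function.Injective f := by
    refine Fin.cons_injective_iff.2 ⟨?_, Fin.cons_injective_iff.2 ⟨?_, ?_⟩⟩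
    · rintro ⟨i, hi⟩
      refine Fin.cases ?_ (fun j => ?_) i hi
      · exact fun h => hav h.symm
      · exact fun h => (he j).1 h
    · rintro ⟨i, hi⟩
      exact (he i).2.1 hi
    · exact Subtype.val_injective.comp e.injective
  have hdeg' : ∀ x ∈ s, x ≠ v → vdeg G x = 3 + if x = a then 1 else 0 := by
    intro x hx hxv
    rw [vdeg_isolate G v, hdeg x (Finset.mem_erase.2 ⟨hxv, hx⟩), if_neg hxv, zero_add]
    simp only [huniq]
  refine PotDiamond.of_embedding (K := sevenGraph) ⟨f, hf⟩ ?_ ?_ ?_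
  · have h0 : vdeg G (f 0) = 4 := by
      change vdeg G a = 4
      rw [hdeg' a has hav, if_pos rfl]
    have h1 : vdeg G (f 1) = 1 := hdv
    have h2 : ∀ i : Fin 5, vdeg G (f i.succ.succ) = 3 := by
      intro i
      change vdeg G (e i) = 3
      rw [hdeg' _ (he i).2.2 (he i).2.1, if_neg (he i).1]
    intro i
    change vdeg sevenGraph i = vdeg G (f i)
    have key : vdeg sevenGraph i = (![4, 1, 3, 3, 3, 3, 3] : Fin 7 → ℕ) i := by
      simp only [vdeg, sevenGraph, Fin.sum_univ_succ, SimpleGraph.fromEdgeSet_adj]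
      fin_cases i <;> simp
    rw [key]
    fin_cases i
    · exact h0.symm
    · exact h1.symm
    · exact (h2 0).symm
    · exact (h2 1).symm
    · exact (h2 2).symm
    · exact (h2 3).symm
    · exact (h2 4).symm
  · intro x hx
    refine vdeg_eq_zero_of_notMem hs fun h => hx ?_
    by_cases h1 : x = a
    · exact ⟨0, h1.symm⟩
    by_cases h2 : x = v
    · exact ⟨1, h2.symm⟩
    refine ⟨(e.symm ⟨x, by simp [h1, h2, h]⟩).succ.succ, ?_⟩
    change (e _ : V) = x
    simp
  · exact ⟨0, 2, 3, 4, by decide, by simp [sevenGraph], by simp [sevenGraph],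
      by simp [sevenGraph], by simp [sevenGraph], by simp [sevenGraph]⟩

end SevenVertices

section Forcing

variable {V : Type*} [Fintype V]

variable (V) in
/-- Every graph supported on `m` vertices with degree sum at least `3 m - 2`, other than a
cubic graph on six vertices, has a degree-preserving rearrangement containing a diamond. -/
def ForcesDiamond (m : ℕ) : Prop :=
  ∀ (s : Finset V) (G : SimpleGraph V), (∀ x y, G.Adj x y → x ∈ s) → s.card = m →
    3 * m ≤ ∑ x, vdeg G x + 2 → (m = 6 → ∃ x ∈ s, vdeg G x ≠ 3) → PotDiamond G

theorem ForcesDiamond.pot_of_isolate {m : ℕ} (hm : ForcesDiamond V m) {G : SimpleGraph V}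
    {s : Finset V} (hs : ∀ x y, G.Adj x y → x ∈ s) (hcard : s.card = m + 1) {v : V} (hv : v ∈ s)
    (hsum : 3 * m + 2 * vdeg G v ≤ ∑ x, vdeg G x + 2)
    (hexc : m = 6 → ∃ x ∈ s.erase v, vdeg (isolate G v) x ≠ 3) : PotDiamond G := by
  refine (hm (s.erase v) (isolate G v) (isolate_supported hs v) ?_ ?_ hexc).of_isolate
  · rw [Finset.card_erase_of_mem hv, hcard, Nat.add_sub_cancel]
  · have := sum_vdeg_isolate G v
    omega

theorem exists_vdeg_ne_of_sum {G : SimpleGraph V} {s : Finset V}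
    (hs : ∀ x y, G.Adj x y → x ∈ s) {k : ℕ} (hsum : ∑ x, vdeg G x ≠ s.card * k) :
    ∃ x ∈ s, vdeg G x ≠ k := by
  by_contra! h
  rw [sum_vdeg_eq_sum hs, Finset.sum_congr rfl h, Finset.sum_const, smul_eq_mul] at hsum
  exact hsum rfl

theorem ForcesDiamond.pot_of_adj {m : ℕ} (hm : ForcesDiamond V m) {G : SimpleGraph V}
    {s : Finset V} (hs : ∀ x y, G.Adj x y → x ∈ s) (hcard : s.card = m + 2) {v w : V}
    (hvw : G.Adj v w) (hv : vdeg G v = 2) (hw : vdeg G w = 2)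
    (hsum : 3 * (m + 2) = ∑ x, vdeg G x + 2) : PotDiamond G := by
  have hvs := hs _ _ hvw
  have hws : w ∈ s.erase v := Finset.mem_erase.2 ⟨hvw.ne', hs _ _ hvw.symm⟩
  have hw' : vdeg (isolate G v) w = 1 := by
    have := vdeg_isolate G v w
    rw [if_neg hvw.ne', if_pos hvw] at this
    omega
  have hc1 : (s.erase v).card = m + 1 := by
    rw [Finset.card_erase_of_mem hvs]
    omega
  have hc2 : ((s.erase v).erase w).card = m := by
    rw [Finset.card_erase_of_mem hws]
    omega
  have s1 := sum_vdeg_isolate G v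
  have s2 := sum_vdeg_isolate (isolate G v) w
  refine (hm.pot_of_isolate (isolate_supported hs v) hc1 hws (by omega) fun h6 => ?_).of_isolate
  apply exists_vdeg_ne_of_sum (isolate_supported (isolate_supported hs v) w)
  omega

theorem ForcesDiamond.pot_of_not_adj {m : ℕ} (hm : ForcesDiamond V m) {G : SimpleGraph V}
    {s : Finset V} (hs : ∀ x y, G.Adj x y → x ∈ s) (hcard : s.card = m + 1) (h5 : 5 ≤ m)
    (h6 : m ≠ 6) (hmin : ∀ x ∈ s, 2 ≤ vdeg G x) {v a b : V} (hv : vdeg G v = 2) (hab : a ≠ b)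
    (hN : ∀ x, G.Adj v x ↔ x = a ∨ x = b) (nab : ¬ G.Adj a b)
    (hsum : 3 * (m + 1) ≤ ∑ x, vdeg G x + 2) : PotDiamond G := by
  have hvs : v ∈ s := mem_of_vdeg_pos hs (by omega)
  have hva := (hN a).2 (Or.inl rfl)
  have hvb := (hN b).2 (Or.inr rfl)
  have hdeg : ∀ x, vdeg G x =
      vdeg (isolate G v ⊔ SimpleGraph.edge a b) x + if x = v then 2 else 0 := by
    intro x
    rw [vdeg_sup_edge hab (fun h : (isolate G v).Adj a b => nab h.1), vdeg_isolate G v x, hv]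
    simp only [hN]
    have := hva.ne
    have := hvb.ne
    grind
  have hK : ∀ x y, (isolate G v ⊔ SimpleGraph.edge a b).Adj x y → x ∈ s.erase v := by
    intro x y h
    rw [SimpleGraph.sup_adj, SimpleGraph.edge_adj] at h
    rcases h with h | ⟨⟨rfl, -⟩ | ⟨rfl, -⟩, -⟩
    · exact isolate_supported hs v x y h
    · exact Finset.mem_erase.2 ⟨hva.ne', hs _ _ hva.symm⟩
    · exact Finset.mem_erase.2 ⟨hvb.ne', hs _ _ hvb.symm⟩
  have hcard' : (s.erase v).card = m := by
    rw [Finset.card_erase_of_mem hvs]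
    omega
  have hsum' : ∑ x, vdeg G x = ∑ x, vdeg (isolate G v ⊔ SimpleGraph.edge a b) x + 2 := by
    rw [Finset.sum_congr rfl fun x _ => hdeg x, Finset.sum_add_distrib,
      Finset.sum_ite_eq' Finset.univ v, if_pos (Finset.mem_univ v)]
  obtain ⟨H, hH, p, q, r, t, hrt, h1, h2, h3, h4, h5⟩ :=
    hm _ _ hK hcard' (by omega) fun h => absurd h h6
  obtain ⟨x, hx, hx'⟩ : ∃ x ∈ s.erase v, x ∉ ({p, q, r, t} : Finset V) := by
    refine Finset.exists_mem_notMem_of_card_lt_card (lt_of_le_of_lt Finset.card_le_four ?_)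
    omega
  obtain ⟨hxv, hxs⟩ := Finset.mem_erase.1 hx
  have hdx := hdeg x
  rw [if_neg hxv, ← hH] at hdx
  obtain ⟨y, hxy⟩ := exists_adj_of_vdeg_pos (G := H) (v := x) (by have := hmin x hxs; omega)
  have hHv : vdeg H v = 0 := by
    have := hdeg v
    rw [if_pos rfl] at this
    rw [hH]
    omega
  refine ⟨subdivide H x y v, fun z => ?_, ?_⟩
  · rw [vdeg_subdivide hxy hHv, hdeg z, hH]
  · refine HasDiamond.mono (G := removeEdge H x y) ?_ (le_sup_left.trans le_sup_left)
    refine ⟨p, q, r, t, hrt, ?_, ?_, ?_, ?_, ?_⟩ <;> rw [removeEdge_adj] <;>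
      simp only [Finset.mem_insert, Finset.mem_singleton] at hx' <;> grind

theorem exists_adj_of_triangles {G : SimpleGraph V} {v a b w c d : V} (hvw : v ≠ w)
    (nvw : ¬ G.Adj v w) (hva : G.Adj v a) (hvb : G.Adj v b) (hab : G.Adj a b)
    (hwc : G.Adj w c) (hwd : G.Adj w d) (hcd : c ≠ d) :
    HasDiamond G ∨ ∃ H : SimpleGraph V, (∀ x, vdeg H x = vdeg G x) ∧ H.Adj v w := by
  by_cases h : ∃ x y, G.Adj v x ∧ G.Adj w y ∧ x ≠ y ∧ ¬ G.Adj x y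
  · obtain ⟨x, y, hvx, hwy, hxy, nxy⟩ := h
    refine Or.inr ⟨switch G v x w y, vdeg_switch hvx hwy hvw hxy nvw nxy, ?_⟩
    simp only [switch, SimpleGraph.sup_adj, SimpleGraph.edge_adj]
    exact Or.inl (Or.inr ⟨Or.inl (by simp), hvw⟩)
  · push Not at h
    left
    have key : ∀ y, G.Adj w y → y ≠ a → y ≠ b → HasDiamond G := fun y hy hya hyb =>
      ⟨a, b, v, y, fun h => nvw (h ▸ hy.symm), hab, hva.symm, h a y hva hy hya.symm, hvb.symm,
        h b y hvb hy hyb.symm⟩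
    by_cases hc : c = a ∨ c = b
    · by_cases hd : d = a ∨ d = b
      · have hwab : G.Adj w a ∧ G.Adj w b := by grind
        exact ⟨a, b, v, w, hvw, hab, hva.symm, hwab.1.symm, hvb.symm, hwab.2.symm⟩
      · push Not at hd
        exact key d hwd hd.1 hd.2
    · push Not at hc
      exact key c hwc hc.1 hc.2

theorem ForcesDiamond.pot_of_min_two {m : ℕ} (hm : ForcesDiamond V m)
    (hm' : ForcesDiamond V (m + 1)) {G : SimpleGraph V} {s : Finset V}
    (hs : ∀ x y, G.Adj x y → x ∈ s) (hcard : s.card = m + 2) (h4 : 4 ≤ m)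
    (hmin : ∀ x ∈ s, 2 ≤ vdeg G x) {v : V} (hv : vdeg G v = 2)
    (hsum : 3 * (m + 2) = ∑ x, vdeg G x + 2) : PotDiamond G := by
  have hpar : m + 1 ≠ 6 := by
    obtain ⟨k, hk⟩ := even_sum_vdeg G
    omega
  have hvs : v ∈ s := mem_of_vdeg_pos hs (by omega)
  obtain ⟨w, hws, hwv, hw⟩ : ∃ w ∈ s, w ≠ v ∧ vdeg G w = 2 := by
    by_contra! h
    have h3 : ∀ x ∈ s.erase v, 3 ≤ vdeg G x := by
      intro x hx
      obtain ⟨hxv, hxs⟩ := Finset.mem_erase.1 hx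
      have := hmin x hxs
      have := h x hxs hxv
      omega
    have hle := Finset.card_nsmul_le_sum _ (fun x => vdeg G x) _ h3
    rw [Finset.card_erase_of_mem hvs, smul_eq_mul] at hle
    rw [sum_vdeg_eq_sum hs, ← Finset.add_sum_erase s _ hvs] at hsum
    omega
  by_cases hvw : G.Adj v w
  · exact hm.pot_of_adj hs hcard hvw hv hw hsum
  obtain ⟨a, b, hab, hN⟩ := exists_of_vdeg_eq_two hv
  obtain ⟨c, d, hcd, hM⟩ := exists_of_vdeg_eq_two hw
  by_cases nab : G.Adj a b
  · rcases exists_adj_of_triangles hwv.symm hvw ((hN a).2 (Or.inl rfl)) ((hN b).2 (Or.inr rfl))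
      nab ((hM c).2 (Or.inl rfl)) ((hM d).2 (Or.inr rfl)) hcd with h | ⟨H, hH, hadj⟩
    · exact h.pot
    · refine PotDiamond.congr (hm.pot_of_adj (s := s) ?_ hcard hadj ?_ ?_ ?_) hH
      · intro x y hxy
        by_contra hx
        exact not_adj_of_vdeg_eq_zero ((hH x).trans (vdeg_eq_zero_of_notMem hs hx)) y hxy
      · rw [hH, hv]
      · rw [hH, hw]
      · simp only [hH, hsum]
  · exact hm'.pot_of_not_adj hs hcard (by omega) hpar hmin hv hab hN nab (by omega)

theorem ForcesDiamond.pot_of_seven (hm : ForcesDiamond V 6) {G : SimpleGraph V} {s : Finset V}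
    (hs : ∀ x y, G.Adj x y → x ∈ s) (hcard : s.card = 7) {v : V} (hv : v ∈ s)
    (hmin : ∀ x ∈ s, vdeg G v ≤ vdeg G x) (hsum : 19 ≤ ∑ x, vdeg G x)
    (hdeg : ∀ x ∈ s.erase v, vdeg (isolate G v) x = 3) : PotDiamond G := by
  have hcard' : (s.erase v).card = 6 := by rw [Finset.card_erase_of_mem hv, hcard]
  have hsum' : ∑ x, vdeg (isolate G v) x = 18 := by
    rw [sum_vdeg_eq_sum (isolate_supported hs v), Finset.sum_congr rfl hdeg, Finset.sum_const,
      smul_eq_mul, hcard']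
  have hsumG := sum_vdeg_isolate G v
  have hdegG : ∀ x ∈ s, x ≠ v → vdeg G x = 3 + if G.Adj v x then 1 else 0 := by
    intro x hx hxv
    rw [vdeg_isolate G v x, hdeg x (Finset.mem_erase.2 ⟨hxv, hx⟩), if_neg hxv, zero_add]
  have finish : ∀ x ∈ s, vdeg G x = vdeg G v + 1 → PotDiamond G := by
    intro x hx h
    have := sum_vdeg_isolate G x
    refine hm.pot_of_isolate hs hcard hx (by omega) fun _ => ?_
    apply exists_vdeg_ne_of_sum (isolate_supported hs x)
    rw [Finset.card_erase_of_mem hx, hcard]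
    omega
  have hne : ∀ k, ∑ x, vdeg G x ≠ vdeg G v + 6 * k → ∃ x ∈ s, x ≠ v ∧ vdeg G x ≠ k := by
    intro k hk
    by_contra! h
    rw [sum_vdeg_eq_sum hs, ← Finset.add_sum_erase s _ hv, Finset.sum_congr rfl fun x hx =>
      h x (Finset.mem_erase.1 hx).2 (Finset.mem_erase.1 hx).1, Finset.sum_const, hcard',
      smul_eq_mul] at hk
    exact hk rfl
  have hd : vdeg G v ≤ 3 := by
    by_contra hd
    obtain ⟨y, hys, hyv, -⟩ := hne 0 (by omega)
    have h3 := hmin y hys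
    have h4 := hdegG y hys hyv
    have h5 : vdeg G v ≤ 4 := by split_ifs at h4 <;> omega
    obtain ⟨x, hxs, hxv, hx⟩ := hne 4 (by omega)
    have h1 := hmin x hxs
    have h2 := hdegG x hxs hxv
    split_ifs at h2 <;> omega
  obtain hd | hd | hd : vdeg G v = 1 ∨ vdeg G v = 2 ∨ vdeg G v = 3 := by omega
  · exact potDiamond_of_leaf hs hcard hv hd hdeg
  · obtain ⟨x, hxs, hxv, hx⟩ := hne 4 (by omega)
    have h2 := hdegG x hxs hxv
    exact finish x hxs (by split_ifs at h2 <;> omega)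
  · obtain ⟨x, hxs, hxv, hx⟩ := hne 3 (by omega)
    have h2 := hdegG x hxs hxv
    exact finish x hxs (by split_ifs at h2 <;> omega)

variable (V) in
theorem forcesDiamond (m : ℕ) (hm : 4 ≤ m) : ForcesDiamond V m := by
  induction m using Nat.strong_induction_on with
  | _ m ih =>
  intro s G hs hcard hsum hexc
  obtain ⟨k, hk⟩ := even_sum_vdeg G
  obtain rfl | ⟨m, rfl⟩ : m = 4 ∨ ∃ l, m = l + 5 := by
    rcases hm.eq_or_lt with h | h
    · exact Or.inl h.symm
    · exact Or.inr ⟨m - 5, by omega⟩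
  · exact (hasDiamond_of_card_eq_four hs hcard (by omega)).pot
  have ih1 : ForcesDiamond V (m + 4) := ih _ (by omega) (by omega)
  obtain ⟨v, hv, hmin⟩ := s.exists_min_image (fun x => vdeg G x)
    (Finset.card_pos.1 (by omega))
  have hle : (m + 5) * vdeg G v ≤ ∑ x, vdeg G x := by
    rw [sum_vdeg_eq_sum hs, ← hcard, ← smul_eq_mul]
    exact Finset.card_nsmul_le_sum _ _ _ hmin
  by_cases hstep : 3 * (m + 4) + 2 * vdeg G v ≤ ∑ x, vdeg G x + 2
  · by_cases hexc' : m + 4 = 6 ∧ ∀ x ∈ s.erase v, vdeg (isolate G v) x = 3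
    · obtain ⟨h6, h3⟩ := hexc'
      obtain rfl : m = 2 := by omega
      exact ih1.pot_of_seven hs hcard hv hmin (by omega) h3
    · push Not at hexc'
      exact ih1.pot_of_isolate hs hcard hv hstep hexc'
  · obtain hd | hd | hd : vdeg G v = 2 ∨ vdeg G v = 3 ∨ 4 ≤ vdeg G v := by omega
    · have hm1 : m ≠ 0 := by omega
      obtain ⟨l, rfl⟩ := Nat.exists_eq_succ_of_ne_zero hm1
      have ih2 : ForcesDiamond V (l + 4) := ih _ (by omega) (by omega)
      exact ih2.pot_of_min_two ih1 hs hcard (by omega) (fun x hx => hd ▸ hmin x hx) hd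
        (by omega)
    · have hreg : ∀ x ∈ s, vdeg G x = 3 := by
        by_contra! h
        obtain ⟨x, hx, hx3⟩ := h
        have hlt : ∑ x ∈ s, 3 < ∑ x ∈ s, vdeg G x :=
          Finset.sum_lt_sum (fun y hy => hd ▸ hmin y hy)
            ⟨x, hx, lt_of_le_of_ne (hd ▸ hmin x hx) hx3.symm⟩
        rw [← sum_vdeg_eq_sum hs, Finset.sum_const, smul_eq_mul, hcard] at hlt
        omega
      have hsum3 : ∑ x, vdeg G x = (m + 5) * 3 := by
        rw [sum_vdeg_eq_sum hs, Finset.sum_congr rfl hreg, Finset.sum_const, smul_eq_mul, hcard]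
      have h6 : m + 5 ≠ 6 := fun h => by
        obtain ⟨x, hx, hx3⟩ := hexc h
        exact hx3 (hreg x hx)
      exact potDiamond_of_cubic hs (by omega) (by rw [hcard, Nat.even_iff]; omega) hreg
    · exfalso
      apply hstep
      nlinarith

end Forcing

section Sharpness

/-- The graph on `Fin n` in which `0` is joined to everything and `1 2`, `3 4`, … are edges. -/
def windmill (n : ℕ) : SimpleGraph (Fin n) where
  Adj i j := i ≠ j ∧ (i.val = 0 ∨ j.val = 0 ∨ (i.val + 1) / 2 = (j.val + 1) / 2)
  symm := ⟨fun _ _ h => ⟨h.1.symm, by tauto⟩⟩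
  loopless := ⟨fun _ h => h.1 rfl⟩

theorem vdeg_windmill_zero (n : ℕ) : vdeg (windmill (n + 1)) 0 = n := by
  have h : ∀ i : Fin n, (windmill (n + 1)).Adj 0 i.succ :=
    fun i => ⟨i.succ_ne_zero.symm, Or.inl rfl⟩
  rw [vdeg, Fin.sum_univ_succ, if_neg (SimpleGraph.irrefl _),
    Finset.sum_congr rfl fun i _ => if_pos (h i)]
  simp

theorem vdeg_windmill_succ_le (n : ℕ) (i : Fin n) : vdeg (windmill (n + 1)) i.succ ≤ 2 := by
  rw [vdeg, Fin.sum_univ_succ]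
  have h1 : (∑ j : Fin n, if (windmill (n + 1)).Adj i.succ j.succ then 1 else 0) ≤ 1 := by
    rw [← Finset.card_filter, Finset.card_le_one]
    simp only [Finset.mem_filter, Finset.mem_univ, true_and, windmill, Fin.ext_iff, Fin.val_succ,
      ne_eq]
    intros
    omega
  split_ifs <;> omega

theorem le_vdeg_windmill_succ (n : ℕ) (i : Fin n) :
    2 ≤ vdeg (windmill (n + 1)) i.succ + if Odd n ∧ i.val + 1 = n then 1 else 0 := by
  rw [vdeg, Fin.sum_univ_succ]
  have h0 : (windmill (n + 1)).Adj i.succ 0 := ⟨i.succ_ne_zero, Or.inr (Or.inl rfl)⟩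
  rw [if_pos h0]
  split_ifs with hi
  · omega
  · obtain ⟨j, hj⟩ : ∃ j : Fin n, (windmill (n + 1)).Adj i.succ j.succ := by
      have hi2 := i.2
      rw [Nat.odd_iff] at hi
      rcases Nat.even_or_odd' i.val with ⟨k, hk | hk⟩
      · refine ⟨⟨i + 1, by omega⟩, ?_, Or.inr (Or.inr ?_)⟩
        · simp [Fin.ext_iff]
        · simp only [Fin.val_succ]
          omega
      · refine ⟨⟨i - 1, by omega⟩, ?_, Or.inr (Or.inr ?_)⟩
        · simp only [Fin.ext_iff, Fin.val_succ, ne_eq]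
          omega
        · simp only [Fin.val_succ]
          omega
    have := Finset.single_le_sum
      (f := fun j : Fin n => if (windmill (n + 1)).Adj i.succ j.succ then 1 else 0)
      (fun _ _ => Nat.zero_le _) (Finset.mem_univ j)
    simp only [hj, if_true] at this
    omega

theorem le_sum_vdeg_windmill (n : ℕ) :
    3 * n ≤ ∑ i, vdeg (windmill (n + 1)) i + if Odd n then 1 else 0 := by
  rw [Fin.sum_univ_succ, vdeg_windmill_zero]
  have h := Finset.sum_le_sum fun i (_ : i ∈ Finset.univ) => le_vdeg_windmill_succ n i
  rw [Finset.sum_add_distrib, Finset.sum_const, Finset.card_univ, Fintype.card_fin,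
    smul_eq_mul] at h
  have h2 : (∑ i : Fin n, if Odd n ∧ i.val + 1 = n then 1 else 0) ≤ if Odd n then 1 else 0 := by
    by_cases hn : Odd n
    · simp only [hn, true_and, if_true]
      rw [← Finset.card_filter, Finset.card_le_one]
      simp only [Finset.mem_filter, Finset.mem_univ, true_and, Fin.ext_iff]
      intros
      omega
    · simp [hn]
  omega

end Sharpness

section Realizations

theorem isRealization_iff {n : ℕ} (S : Fin n → ℕ) (G : SimpleGraph (Fin n)) :
    IsRealization S G ↔
      Multiset.map (fun v => vdeg G v) Finset.univ.val = Multiset.map S Finset.univ.val := by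
  simp only [IsRealization, vdeg_eq_degree]

theorem IsRealization.sum_eq {n : ℕ} {S : Fin n → ℕ} {G : SimpleGraph (Fin n)}
    (h : IsRealization S G) : ∑ i, vdeg G i = ∑ i, S i :=
  congrArg Multiset.sum ((isRealization_iff S G).1 h)

theorem IsRealization.card_filter_eq {n : ℕ} {S : Fin n → ℕ} {G : SimpleGraph (Fin n)}
    (h : IsRealization S G) (k : ℕ) :
    (Finset.univ.filter fun i => k ≤ vdeg G i).card =
      (Finset.univ.filter fun i => k ≤ S i).card := by
  have := congrArg (Multiset.countP fun d => k ≤ d) ((isRealization_iff S G).1 h)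
  rwa [Multiset.countP_map, Multiset.countP_map] at this

theorem HasDiamond.containsSub {n : ℕ} {G : SimpleGraph (Fin n)} (h : HasDiamond G) :
    ContainsSub G K4e := by
  obtain ⟨p, q, r, t, hrt, h1, h2, h3, h4, h5⟩ := h
  have d1 := h1.ne
  have d2 := h2.ne
  have d3 := h3.ne
  have d4 := h4.ne
  have d5 := h5.ne
  have hadj : ∀ i j, K4e.Adj i j → G.Adj (![r, t, p, q] i) (![r, t, p, q] j) := by
    intro i j hij
    fin_cases i <;> fin_cases j <;> simp_all [K4e, SimpleGraph.adj_comm]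
  refine ⟨⟨![r, t, p, q], ?_⟩, hadj⟩
  intro i j hij
  fin_cases i <;> fin_cases j <;> simp_all

theorem ContainsSub.two_le_card {n : ℕ} {G : SimpleGraph (Fin n)} (h : ContainsSub G K4e) :
    2 ≤ (Finset.univ.filter fun i => 3 ≤ vdeg G i).card := by
  obtain ⟨f, hf⟩ := h
  have hdeg : ∀ i, (∀ j, j ≠ i → K4e.Adj i j) → 3 ≤ vdeg G (f i) := by
    intro i hi
    rw [vdeg_eq_card]
    calc 3 = ((Finset.univ.erase i).map f).card := by simp
      _ ≤ _ := Finset.card_le_card ?_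
    intro x hx
    obtain ⟨j, hj, rfl⟩ := Finset.mem_map.1 hx
    exact Finset.mem_filter.2 ⟨Finset.mem_univ _, hf _ _ (hi j (Finset.ne_of_mem_erase hj))⟩
  have h2 : 3 ≤ vdeg G (f 2) := hdeg 2 fun j hj => by
    fin_cases j <;> simp_all [K4e]
  have h3 : 3 ≤ vdeg G (f 3) := hdeg 3 fun j hj => by
    fin_cases j <;> simp_all [K4e]
  refine Finset.one_lt_card.2 ⟨f 2, by simpa using h2, f 3, by simpa using h3, ?_⟩
  exact f.injective.ne (by decide)

end Realizations

theorem stmt_13 (n : ℕ) (hn : n = 4 ∨ n = 5 ∨ 7 ≤ n) :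
    IsLeast
      {m : ℕ | Even m ∧
        ∀ S : Fin n → ℕ, Graphical S → m ≤ ∑ i, S i →
          ∃ G : SimpleGraph (Fin n), IsRealization S G ∧ ContainsSub G K4e}
      (if Odd n then 3 * n - 1 else 3 * n - 2) := by
  refine ⟨⟨?_, ?_⟩, ?_⟩
  · split_ifs with h
    · rw [Nat.odd_iff] at h
      rw [Nat.even_iff]
      omega
    · rw [Nat.odd_iff] at h
      rw [Nat.even_iff]
      omega
  · rintro S ⟨G, hG⟩ hS
    obtain ⟨H, hH, hd⟩ := forcesDiamond (Fin n) n (by omega) Finset.univ G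
      (fun x _ _ => Finset.mem_univ x) (by simp)
      (by rw [hG.sum_eq]; split_ifs at hS <;> omega) (by omega)
    refine ⟨H, (isRealization_iff S H).2 ?_, hd.containsSub⟩
    simp only [hH]
    exact (isRealization_iff S G).1 hG
  · rintro m ⟨hm, hforce⟩
    by_contra! hlt
    obtain ⟨n, rfl⟩ : ∃ l, n = l + 1 := ⟨n - 1, by omega⟩
    have hW : IsRealization (fun i => vdeg (windmill (n + 1)) i) (windmill (n + 1)) :=
      (isRealization_iff _ _).2 rfl
    obtain ⟨H, hH, hsub⟩ := hforce _ ⟨_, hW⟩ (by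
      have := le_sum_vdeg_windmill n
      rw [Nat.even_iff] at hm
      simp only [Nat.odd_iff] at hlt this
      split_ifs at hlt this <;> omega)
    have h2 := hsub.two_le_card
    rw [hH.card_filter_eq] at h2
    obtain ⟨x, hx, y, hy, hxy⟩ := Finset.one_lt_card.1 h2
    have big : ∀ z : Fin (n + 1), 3 ≤ vdeg (windmill (n + 1)) z → z = 0 := by
      intro z hz
      refine Fin.cases (motive := fun z => 3 ≤ vdeg (windmill (n + 1)) z → z = 0)
        (fun _ => rfl) (fun i hi => ?_) z hz
      have := vdeg_windmill_succ_le n i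
      omega
    exact hxy ((big x (Finset.mem_filter.1 hx).2).trans (big y (Finset.mem_filter.1 hy).2).symm)
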